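/- Let C = 150, let C ≤ α = α(n) ≤ n/ln n, let p = p(n) = α·ln n/n, and let G ~ G(n,p). Then with high probability, for every set A ⊆ [n] with |A| = n·(ln ln n)^{1.5}/ln n there exist at most |A|/2 vertices v ∉ A for which |E(v,A)| ≤ α·(ln ln n)^{1.5}/2, where E(v,A) is the set of edges of G joining v to a vertex of A. -/

import Mathlib

open Filter Real

open scoped Classical BigOperators

/-- Probability that `G(n,p)` satisfies the property `P`. -/
noncomputable def gnpProb (n : ℕ) (q : ℝ) (P : SimpleGraph (Fin n) → Prop) : ℝ :=
  ∑ G : SimpleGraph (Fin n),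
    if P G then q ^ G.edgeSet.ncard * (1 - q) ^ (n.choose 2 - G.edgeSet.ncard) else 0

/-- The number of edges of `G` with first endpoint in `A` and second endpoint in `B`.
For `v ∉ A`, `edgeCount G {v} A` is the number of edges of `G` joining `v` to `A`. -/
noncomputable def edgeCount {V : Type*} (G : SimpleGraph V) (A B : Set V) : ℕ :=
  {q : V × V | q.1 ∈ A ∧ q.2 ∈ B ∧ G.Adj q.1 q.2}.ncard

/-- The probability of the graph `G` under `G(n,q)`. -/
noncomputable def gnpWeight (n : ℕ) (q : ℝ) (G : SimpleGraph (Fin n)) : ℝ :=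
  q ^ G.edgeSet.ncard * (1 - q) ^ (n.choose 2 - G.edgeSet.ncard)

theorem gnpWeight_nonneg {n : ℕ} {q : ℝ} (h0 : 0 ≤ q) (h1 : q ≤ 1) (G : SimpleGraph (Fin n)) :
    0 ≤ gnpWeight n q G :=
  mul_nonneg (pow_nonneg h0 _) (pow_nonneg (sub_nonneg.2 h1) _)

theorem sum_simpleGraph_eq_sum_powerset {V : Type*} [Fintype V] [DecidableEq V] (f : Finset (Sym2 V) → ℝ) :
    ∑ G : SimpleGraph V, f G.edgeFinset =
      ∑ T ∈ (⊤ : SimpleGraph V).edgeFinset.powerset, f T := by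
  refine Finset.sum_bij' (fun G _ => G.edgeFinset)
    (fun T _ => SimpleGraph.fromEdgeSet (T : Set (Sym2 V))) ?_ ?_ ?_ ?_ ?_
  · intro G _
    rw [Finset.mem_powerset]
    exact SimpleGraph.edgeFinset_mono le_top
  · simp
  · intro G _
    simp
  · intro T hT
    rw [Finset.mem_powerset] at hT
    ext e
    have he : e ∈ T → ¬ e.IsDiag := fun h => by
      simpa using hT h
    simpa using he
  · simp

/-- The generating function of the number of edges of `G(n,q)` inside a set `F` of pairs. -/
theorem sum_gnpWeight_mul_pow (n : ℕ) (q x : ℝ) {F : Finset (Sym2 (Fin n))}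
    (hF : F ⊆ (⊤ : SimpleGraph (Fin n)).edgeFinset) :
    ∑ G : SimpleGraph (Fin n), gnpWeight n q G * x ^ (G.edgeFinset ∩ F).card =
      (1 - q + q * x) ^ F.card := by
  set E := (⊤ : SimpleGraph (Fin n)).edgeFinset with hE
  have hcard : E.card = n.choose 2 := by
    rw [hE, SimpleGraph.card_edgeFinset_top_eq_card_choose_two, Fintype.card_fin]
  have hw : ∀ G : SimpleGraph (Fin n), gnpWeight n q G * x ^ (G.edgeFinset ∩ F).card =
      q ^ G.edgeFinset.card * (1 - q) ^ (n.choose 2 - G.edgeFinset.card) *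
        x ^ (G.edgeFinset ∩ F).card := by
    intro G
    rw [gnpWeight, ← SimpleGraph.coe_edgeFinset G, Set.ncard_coe_finset]
  have hsum := sum_simpleGraph_eq_sum_powerset (V := Fin n) fun T =>
    q ^ T.card * (1 - q) ^ (n.choose 2 - T.card) * x ^ (T ∩ F).card
  rw [Finset.sum_congr rfl fun G _ => hw G]
  refine hsum.trans ?_
  have hprod : ∏ e ∈ E, ((if e ∈ F then q * x else q) + (1 - q)) = (1 - q + q * x) ^ F.card := by
    have : ∀ e ∈ E, ((if e ∈ F then q * x else q) + (1 - q)) =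
        if e ∈ F then (1 - q + q * x) else 1 := by
      intro e _
      split_ifs <;> ring
    rw [Finset.prod_congr rfl this, Finset.prod_ite_mem, Finset.inter_eq_right.2 hF,
      Finset.prod_const]
  rw [← hprod, Finset.prod_add]
  refine Finset.sum_congr rfl fun T hT => ?_
  rw [Finset.mem_powerset] at hT
  have h1 : ∏ e ∈ T, (if e ∈ F then q * x else q) = q ^ T.card * x ^ (T ∩ F).card := by
    have : ∀ e ∈ T, (if e ∈ F then q * x else q) = q * (if e ∈ F then x else 1) := by
      intro e _
      split_ifs <;> ring
    rw [Finset.prod_congr rfl this, Finset.prod_mul_distrib, Finset.prod_const,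
      Finset.prod_ite_mem, Finset.prod_const]
  rw [h1, Finset.prod_const, Finset.card_sdiff_of_subset hT, hcard]
  ring

theorem sum_gnpWeight (n : ℕ) (q : ℝ) : ∑ G : SimpleGraph (Fin n), gnpWeight n q G = 1 := by
  simpa using sum_gnpWeight_mul_pow n q 1 (Finset.empty_subset _)

theorem gnpProb_eq_one_sub (n : ℕ) (q : ℝ) (P : SimpleGraph (Fin n) → Prop) :
    gnpProb n q P = 1 - ∑ G : SimpleGraph (Fin n), if P G then 0 else gnpWeight n q G := by
  rw [← sum_gnpWeight n q, ← Finset.sum_sub_distrib]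
  refine Finset.sum_congr rfl fun G _ => ?_
  split_ifs <;> simp [gnpWeight]

/-- The pairs joining `S` to `A`. -/
noncomputable def crossPairs {V : Type*} [DecidableEq V] (S A : Finset V) : Finset (Sym2 V) :=
  (S ×ˢ A).image fun q => s(q.1, q.2)

theorem card_crossPairs {V : Type*} [DecidableEq V] {S A : Finset V} (h : Disjoint S A) :
    (crossPairs S A).card = S.card * A.card := by
  rw [crossPairs, Finset.card_image_of_injOn, Finset.card_product]
  rintro ⟨a, b⟩ hab ⟨c, d⟩ hcd he
  simp only [Finset.coe_product, Set.mem_prod, Finset.mem_coe] at hab hcd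
  rcases Sym2.eq_iff.1 he with ⟨h1, h2⟩ | ⟨h1, h2⟩
  · exact Prod.ext h1 h2
  · obtain rfl : a = d := h1
    exact absurd hcd.2 (Finset.disjoint_left.1 h hab.1)

theorem crossPairs_subset {V : Type*} [Fintype V] [DecidableEq V] {S A : Finset V} (h : Disjoint S A) :
    crossPairs S A ⊆ (⊤ : SimpleGraph V).edgeFinset := by
  intro e he
  obtain ⟨⟨a, b⟩, hab, rfl⟩ := Finset.mem_image.1 he
  rw [Finset.mem_product] at hab
  have : a ≠ b := fun hh => Finset.disjoint_left.1 h hab.1 (hh ▸ hab.2)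
  simpa using this

theorem edgeCount_singleton {V : Type*} [Fintype V] [DecidableEq V] (G : SimpleGraph V) (v : V) (A : Finset V) :
    edgeCount G {v} (A : Set V) = (A.filter fun a => G.Adj v a).card := by
  have : {q : V × V | q.1 ∈ ({v} : Set V) ∧ q.2 ∈ (A : Set V) ∧ G.Adj q.1 q.2} =
      (((A.filter fun a => G.Adj v a).image fun a => (v, a) : Finset (V × V)) : Set (V × V)) := by
    ext ⟨a, b⟩
    simp only [Set.mem_ofPred_eq, Set.mem_singleton_iff, Finset.mem_coe, Finset.mem_image,
      Finset.mem_filter, Prod.mk.injEq]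
    constructor
    · rintro ⟨rfl, hb, hab⟩
      exact ⟨b, ⟨hb, hab⟩, rfl, rfl⟩
    · rintro ⟨c, ⟨hc, hvc⟩, rfl, rfl⟩
      exact ⟨rfl, hc, hvc⟩
  rw [edgeCount, this, Set.ncard_coe_finset,
    Finset.card_image_of_injective _ (Prod.mk_right_injective v)]

theorem card_edgeFinset_inter_crossPairs_le {V : Type*} [Fintype V] [DecidableEq V] (G : SimpleGraph V)
    (S A : Finset V) :
    (G.edgeFinset ∩ crossPairs S A).card ≤ ∑ v ∈ S, edgeCount G {v} (A : Set V) := by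
  have hsub : G.edgeFinset ∩ crossPairs S A ⊆
      S.biUnion fun v => (A.filter fun a => G.Adj v a).image fun a => s(v, a) := by
    intro e he
    rw [Finset.mem_inter] at he
    obtain ⟨he, hc⟩ := he
    obtain ⟨⟨a, b⟩, hab, rfl⟩ := Finset.mem_image.1 hc
    rw [Finset.mem_product] at hab
    rw [SimpleGraph.mem_edgeFinset, SimpleGraph.mem_edgeSet] at he
    exact Finset.mem_biUnion.2 ⟨a, hab.1,
      Finset.mem_image.2 ⟨b, Finset.mem_filter.2 ⟨hab.2, he⟩, rfl⟩⟩
  refine (Finset.card_le_card hsub).trans (Finset.card_biUnion_le.trans ?_)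
  refine Finset.sum_le_sum fun v _ => ?_
  rw [edgeCount_singleton]
  exact Finset.card_image_le

/-- First moment bound for the existence of a set of size `s` from which more than `s / 2` outside
vertices receive at most `t` edges. -/
theorem one_sub_le_gnpProb {n s : ℕ} {q t : ℝ} (h0 : 0 ≤ q) (h1 : q ≤ 1) :
    1 - (n.choose s : ℝ) * n.choose (s / 2 + 1) *
        ((2 : ℝ) ^ (((s / 2 + 1 : ℕ) : ℝ) * t) * (1 - q / 2) ^ ((s / 2 + 1) * s)) ≤
      gnpProb n q (fun G => ∀ A : Finset (Fin n), A.card = s →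
        ({v : Fin n | v ∉ A ∧ (edgeCount G {v} (↑A : Set (Fin n)) : ℝ) ≤ t}.ncard : ℝ) ≤
          (A.card : ℝ) / 2) := by
  set k := s / 2 + 1 with hk
  rw [gnpProb_eq_one_sub]
  refine sub_le_sub_left ?_ 1
  set PA := Finset.powersetCard s (Finset.univ : Finset (Fin n))
  set PS := Finset.powersetCard k (Finset.univ : Finset (Fin n))
  set c : ℝ := (2 : ℝ) ^ ((k : ℝ) * t) with hc
  have hc0 : 0 < c := Real.rpow_pos_of_pos two_pos _
  have hpt : ∀ G : SimpleGraph (Fin n), ∀ A S : Finset (Fin n),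
      0 ≤ if Disjoint S A then
        c * (gnpWeight n q G * (1 / 2 : ℝ) ^ (G.edgeFinset ∩ crossPairs S A).card) else 0 := by
    intro G A S
    split_ifs
    · have := gnpWeight_nonneg h0 h1 G
      positivity
    · exact le_rfl
  calc _ ≤ ∑ G : SimpleGraph (Fin n), ∑ A ∈ PA, ∑ S ∈ PS, (if Disjoint S A then
        c * (gnpWeight n q G * (1 / 2 : ℝ) ^ (G.edgeFinset ∩ crossPairs S A).card) else 0) := by
        refine Finset.sum_le_sum fun G _ => ?_
        split_ifs with hG
        · exact Finset.sum_nonneg fun A _ => Finset.sum_nonneg fun S _ => hpt G A S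
        push Not at hG
        obtain ⟨A, hA, hlt⟩ := hG
        set B := Finset.univ.filter fun v : Fin n =>
          v ∉ A ∧ (edgeCount G {v} (↑A : Set (Fin n)) : ℝ) ≤ t with hB
        have hBc : {v : Fin n | v ∉ A ∧ (edgeCount G {v} (↑A : Set (Fin n)) : ℝ) ≤ t} =
            (B : Set (Fin n)) := by
          ext v; simp [hB]
        rw [hBc, Set.ncard_coe_finset, hA] at hlt
        have hkB : k ≤ B.card := by
          have : (s : ℝ) < 2 * B.card := by linarith
          have : s < 2 * B.card := by exact_mod_cast this
          omega
        obtain ⟨S, hSB, hS⟩ := Finset.exists_subset_card_eq hkB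
        have hdis : Disjoint S A := Finset.disjoint_left.2 fun v hv =>
          (Finset.mem_filter.1 (hSB hv)).2.1
        have hAm : A ∈ PA := Finset.mem_powersetCard.2 ⟨Finset.subset_univ _, hA⟩
        have hSm : S ∈ PS := Finset.mem_powersetCard.2 ⟨Finset.subset_univ _, hS⟩
        refine le_trans ?_ (Finset.single_le_sum
          (fun A _ => Finset.sum_nonneg fun S _ => hpt G A S) hAm)
        refine le_trans ?_ (Finset.single_le_sum (fun S _ => hpt G A S) hSm)
        rw [if_pos hdis]
        have hle : ((G.edgeFinset ∩ crossPairs S A).card : ℝ) ≤ k * t := by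
          calc ((G.edgeFinset ∩ crossPairs S A).card : ℝ)
              ≤ ((∑ v ∈ S, edgeCount G {v} (A : Set (Fin n)) : ℕ) : ℝ) := by
                exact_mod_cast card_edgeFinset_inter_crossPairs_le G S A
            _ = ∑ v ∈ S, (edgeCount G {v} (A : Set (Fin n)) : ℝ) := by push_cast; rfl
            _ ≤ ∑ _v ∈ S, t := Finset.sum_le_sum fun v hv => (Finset.mem_filter.1 (hSB hv)).2.2
            _ = k * t := by rw [Finset.sum_const, hS, nsmul_eq_mul]
        have hone : 1 ≤ c * (1 / 2 : ℝ) ^ (G.edgeFinset ∩ crossPairs S A).card := by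
          rw [one_div, inv_pow, ← Real.rpow_natCast, ← div_eq_mul_inv,
            one_le_div (Real.rpow_pos_of_pos two_pos _)]
          exact Real.rpow_le_rpow_of_exponent_le one_le_two hle
        calc gnpWeight n q G = gnpWeight n q G * 1 := (mul_one _).symm
          _ ≤ gnpWeight n q G * (c * (1 / 2 : ℝ) ^ (G.edgeFinset ∩ crossPairs S A).card) :=
            mul_le_mul_of_nonneg_left hone (gnpWeight_nonneg h0 h1 G)
          _ = _ := by ring
    _ = ∑ A ∈ PA, ∑ S ∈ PS, (if Disjoint S A then c * (1 - q / 2) ^ (k * s) else 0) := by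
        rw [Finset.sum_comm]
        refine Finset.sum_congr rfl fun A hA => ?_
        rw [Finset.sum_comm]
        refine Finset.sum_congr rfl fun S hS => ?_
        split_ifs with hd
        · rw [← Finset.mul_sum, sum_gnpWeight_mul_pow n q _ (crossPairs_subset hd),
            card_crossPairs hd, (Finset.mem_powersetCard.1 hA).2, (Finset.mem_powersetCard.1 hS).2]
          ring_nf
        · simp
    _ ≤ ∑ _A ∈ PA, ∑ _S ∈ PS, c * (1 - q / 2) ^ (k * s) := by
        refine Finset.sum_le_sum fun A _ => Finset.sum_le_sum fun S _ => ?_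
        have : 0 ≤ 1 - q / 2 := by linarith
        split_ifs
        · exact le_rfl
        · positivity
    _ = _ := by
        simp only [Finset.sum_const, PA, PS, Finset.card_powersetCard, Finset.card_univ,
          Fintype.card_fin, nsmul_eq_mul]
        ring

theorem choose_le_exp_mul {n r : ℕ} {l : ℝ} (hr : 0 < r)
    (h : (n : ℝ) * Real.exp 1 ≤ r * Real.exp l) : (n.choose r : ℝ) ≤ Real.exp (r * l) := by
  have hr' : (0 : ℝ) < r := by exact_mod_cast hr
  have hf : (0 : ℝ) < r.factorial := by exact_mod_cast r.factorial_pos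
  have h1 : (n.choose r : ℝ) ≤ (n : ℝ) ^ r / r.factorial := Nat.choose_le_pow_div r n
  have h2 : (r : ℝ) ^ r / r.factorial ≤ Real.exp r := Real.pow_div_factorial_le_exp _ hr'.le r
  have h3 : ((n : ℝ) * Real.exp 1) ^ r ≤ (r * Real.exp l) ^ r :=
    pow_le_pow_left₀ (by positivity) h r
  rw [mul_pow, mul_pow, ← Real.exp_nat_mul, ← Real.exp_nat_mul, mul_one] at h3
  rw [div_le_iff₀ hf] at h2
  refine h1.trans ?_
  rw [div_le_iff₀ hf]
  refine le_of_mul_le_mul_right ?_ (Real.exp_pos (r : ℝ))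
  calc (n : ℝ) ^ r * Real.exp r ≤ r ^ r * Real.exp (r * l) := h3
    _ ≤ Real.exp r * r.factorial * Real.exp (r * l) := by gcongr
    _ = _ := by ring

theorem first_moment_bound {n s : ℕ} {a l w : ℝ} (ha : 150 ≤ a) (hl : 1 ≤ l) (hlw : l ≤ w)
    (hw : 6 ≤ w) (hn : 0 < n) (haq : a * Real.exp l / n ≤ 1)
    (hs : (n : ℝ) * w / Real.exp l ≤ s) :
    (n.choose s : ℝ) * n.choose (s / 2 + 1) *
        ((2 : ℝ) ^ (((s / 2 + 1 : ℕ) : ℝ) * (a * w / 2)) *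
          (1 - a * Real.exp l / n / 2) ^ ((s / 2 + 1) * s)) ≤ Real.exp (-l) := by
  have hn' : (0 : ℝ) < n := by exact_mod_cast hn
  have hL := Real.exp_pos l
  set q := a * Real.exp l / n with hq
  set k := s / 2 + 1 with hk
  have hs0 : (0 : ℝ) < s := lt_of_lt_of_le (by positivity) hs
  have hs1 : 0 < s := by exact_mod_cast hs0
  have hsk : (s : ℝ) ≤ 2 * k := by
    have : s ≤ 2 * k := by omega
    exact_mod_cast this
  have hk1 : (1 : ℝ) ≤ k := by
    have : 1 ≤ k := by omega
    exact_mod_cast this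
  have hnw : (n : ℝ) * w ≤ s * Real.exp l := (div_le_iff₀ hL).1 hs
  have he : Real.exp 1 ≤ 3 := by linarith [Real.exp_one_lt_d9]
  have c1 : (n.choose s : ℝ) ≤ Real.exp (s * l) := by
    refine choose_le_exp_mul hs1 (le_trans ?_ hnw)
    gcongr
    linarith
  have c2 : (n.choose k : ℝ) ≤ Real.exp (k * l) := by
    refine choose_le_exp_mul (by omega) ?_
    have : (n : ℝ) * Real.exp 1 ≤ n * (w / 2) := by
      gcongr
      linarith
    have : (s : ℝ) * Real.exp l ≤ 2 * k * Real.exp l := by gcongr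
    linarith
  have hsq : a * w ≤ s * q := by
    rw [hq, mul_div_assoc', le_div_iff₀ hn']
    nlinarith
  have c3 : (1 - q / 2) ^ (k * s) ≤ Real.exp (-(k * (a * w) / 2)) := by
    calc (1 - q / 2) ^ (k * s) ≤ (Real.exp (-(q / 2))) ^ (k * s) :=
          pow_le_pow_left₀ (by linarith) (Real.one_sub_le_exp_neg _) _
      _ = Real.exp (-(k * (s * q) / 2)) := by
          rw [← Real.exp_nat_mul]
          push_cast
          ring_nf
      _ ≤ _ := by gcongr
  have c4 : (2 : ℝ) ^ ((k : ℝ) * (a * w / 2)) ≤ Real.exp (0.7 * (k * (a * w / 2))) := by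
    rw [Real.rpow_def_of_pos two_pos]
    have := Real.log_two_lt_d9
    gcongr
    linarith
  have hq0 : 0 ≤ 1 - q / 2 := by linarith
  calc _ ≤ Real.exp (s * l) * Real.exp (k * l) *
        (Real.exp (0.7 * (k * (a * w / 2))) * Real.exp (-(k * (a * w) / 2))) := by
        gcongr
    _ = Real.exp (s * l + k * l - 0.15 * (k * (a * w))) := by
        simp only [← Real.exp_add]
        congr 1
        ring
    _ ≤ Real.exp (-l) := by
        refine Real.exp_le_exp.2 ?_
        have h1 : (s : ℝ) * l ≤ 2 * k * l := by gcongr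
        have h2 : (k : ℝ) * (150 * l) ≤ k * (a * w) := by gcongr
        have h3 : 1 * l ≤ k * l := by gcongr
        linarith

theorem stmt10 (α : ℕ → ℝ)
    (hα : ∀ᶠ n : ℕ in atTop, 150 ≤ α n ∧ α n ≤ (n : ℝ) / Real.log n) :
    Tendsto (fun n : ℕ =>
      gnpProb n (α n * Real.log n / n) (fun G =>
        ∀ A : Finset (Fin n),
          A.card = ⌈(n : ℝ) * (Real.log (Real.log n)) ^ (1.5 : ℝ) / Real.log n⌉₊ →
          ({v : Fin n | v ∉ A ∧
              (edgeCount G {v} (↑A : Set (Fin n)) : ℝ) ≤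
                α n * (Real.log (Real.log n)) ^ (1.5 : ℝ) / 2}.ncard : ℝ) ≤
            (A.card : ℝ) / 2))
      atTop (nhds 1) := by
  have hlog : Tendsto (fun n : ℕ => Real.log n) atTop atTop :=
    Real.tendsto_log_atTop.comp tendsto_natCast_atTop_atTop
  have hll : Tendsto (fun n : ℕ => Real.log (Real.log n)) atTop atTop :=
    Real.tendsto_log_atTop.comp hlog
  have hlim : Tendsto (fun n : ℕ => 1 - Real.exp (-Real.log (Real.log n))) atTop (nhds 1) := by
    simpa using (Real.tendsto_exp_neg_atTop_nhds_zero.comp hll).const_sub 1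
  have hq : ∀ᶠ n : ℕ in atTop, 0 ≤ α n * Real.log n / n ∧ α n * Real.log n / n ≤ 1 := by
    filter_upwards [hα, hlog.eventually_gt_atTop 0, eventually_gt_atTop 0] with n hn hL hn0
    have hn' : (0 : ℝ) < n := by exact_mod_cast hn0
    refine ⟨div_nonneg (mul_nonneg (by linarith) hL.le) hn'.le, ?_⟩
    rw [div_le_one hn']
    exact (le_div_iff₀ hL).1 hn.2
  refine tendsto_of_tendsto_of_tendsto_of_le_of_le' hlim tendsto_const_nhds ?_ ?_
  · filter_upwards [hα, hq, hlog.eventually_gt_atTop 0, hll.eventually_ge_atTop 6,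
      eventually_gt_atTop 0] with n hn hqn hL hl hn0
    have hexp : Real.exp (Real.log (Real.log n)) = Real.log n := Real.exp_log hL
    have hlw : Real.log (Real.log n) ≤ Real.log (Real.log n) ^ (1.5 : ℝ) :=
      Real.self_le_rpow_of_one_le (by linarith) (by norm_num)
    have hb := first_moment_bound (n := n) (a := α n)
      (s := ⌈(n : ℝ) * (Real.log (Real.log n)) ^ (1.5 : ℝ) / Real.log n⌉₊)
      hn.1 (by linarith) hlw (hl.trans hlw) hn0 (by rw [hexp]; exact hqn.2)
      (by rw [hexp]; exact Nat.le_ceil _)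
    rw [hexp] at hb
    exact (sub_le_sub_left hb 1).trans (one_sub_le_gnpProb hqn.1 hqn.2)
  · filter_upwards [hq] with n hqn
    rw [gnpProb_eq_one_sub]
    refine sub_le_self _ (Finset.sum_nonneg fun G _ => ?_)
    split_ifs
    · exact le_rfl
    · exact gnpWeight_nonneg hqn.1 hqn.2 G
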